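/- Let P be an n-dimensional lattice polytope whose normal fan is Gorenstein (Q-Gorenstein of index 1) and which is Q-normal (μ(P) = τ(P)). If cd(P) > (n+2)/2, then P is unimodularly equivalent to a Cayley sum of lattice polytopes of dimension at most 2(n + 1 − cd(P)). -/

import Mathlib

open scoped BigOperators Pointwise

noncomputable section

/-- Pairing `⟨a, x⟩ = ∑ aⱼ xⱼ` of an integer linear functional with a real point. -/
def ipair {n : ℕ} (a : Fin n → ℤ) (x : Fin n → ℝ) : ℝ := ∑ j, (a j : ℝ) * x j

/-- An integer vector is primitive if it is nonzero and not a nontrivial integer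
multiple of another integer vector. -/
def IsPrimitive {n : ℕ} (a : Fin n → ℤ) : Prop :=
  a ≠ 0 ∧ ∀ (k : ℤ) (b : Fin n → ℤ), a = k • b → IsUnit k

/-- The set of integer (lattice) points of `ℝⁿ`. -/
def IntPts (n : ℕ) : Set (Fin n → ℝ) := Set.range (fun z : Fin n → ℤ => fun j => (z j : ℝ))

/-- The dimension of a subset of `ℝⁿ` (the dimension of its affine hull). -/
def setDim {n : ℕ} (S : Set (Fin n → ℝ)) : ℕ := Module.finrank ℝ (vectorSpan ℝ S)

/-- An irredundant facet description `P = {x : A x ≥ b}` of an `n`-dimensional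
rational polytope: the rows `aᵢ` of `A` are primitive integer vectors, the right hand
sides are rational, `P` is bounded and `n`-dimensional, every inequality defines a facet
(a face of dimension `n-1`), and no inequality is repeated. -/
structure PolyDesc (n m : ℕ) : Type where
  hm : 0 < m
  A : Fin m → Fin n → ℤ
  b : Fin m → ℚ
  prim : ∀ i, IsPrimitive (A i)
  bounded : Bornology.IsBounded {x : Fin n → ℝ | ∀ i, (b i : ℝ) ≤ ipair (A i) x}
  fulldim : setDim {x : Fin n → ℝ | ∀ i, (b i : ℝ) ≤ ipair (A i) x} = n
  facet_dim : ∀ i, setDim {x : Fin n → ℝ |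
      (∀ j, (b j : ℝ) ≤ ipair (A j) x) ∧ ipair (A i) x = (b i : ℝ)} + 1 = n
  irredundant : Function.Injective (fun i => (A i, b i))

namespace PolyDesc

variable {n m : ℕ} (D : PolyDesc n m)

/-- The polytope `P` itself. -/
def pts : Set (Fin n → ℝ) := {x | ∀ i, (D.b i : ℝ) ≤ ipair (D.A i) x}

/-- Lattice distance `d_{Fᵢ}(x) = ⟨aᵢ, x⟩ - bᵢ` from (the hyperplane spanned by)
the `i`-th facet. -/
def dF (i : Fin m) (x : Fin n → ℝ) : ℝ := ipair (D.A i) x - (D.b i : ℝ)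

/-- Lattice distance `d_P(x) = minᵢ d_{Fᵢ}(x)` from the boundary of `P`. -/
def dist (x : Fin n → ℝ) : ℝ :=
  Finset.univ.inf'
    (Finset.univ_nonempty_iff.mpr (Fin.pos_iff_nonempty.mp D.hm))
    (fun i => D.dF i x)

/-- The adjoint polytope `P⁽ˢ⁾ = {x : d_P(x) ≥ s}`. -/
def adj (s : ℝ) : Set (Fin n → ℝ) := {x | s ≤ D.dist x}

/-- The `i`-th facet `Fᵢ` of `P`. -/
def facet (i : Fin m) : Set (Fin n → ℝ) := {x ∈ D.pts | ipair (D.A i) x = (D.b i : ℝ)}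

/-- The set `{s > 0 : P⁽ˢ⁾ ≠ ∅}`, whose supremum is `μ(P)⁻¹`. -/
def qcdInvSet : Set ℝ := {s : ℝ | 0 < s ∧ (D.adj s).Nonempty}

/-- `μ(P)⁻¹ = sup {s > 0 : P⁽ˢ⁾ ≠ ∅}`. -/
def qcdInv : ℝ := sSup D.qcdInvSet

/-- The ℚ-codegree `μ(P) = (sup {s > 0 : P⁽ˢ⁾ ≠ ∅})⁻¹`. -/
def qcd : ℝ := D.qcdInv⁻¹

/-- The core `core(P) = P^{(1/μ(P))}`. -/
def core : Set (Fin n → ℝ) := D.adj D.qcdInv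

/-- The codegree `cd(P) = min {k ∈ ℕ, k ≥ 1 : int(kP) ∩ ℤⁿ ≠ ∅}`. -/
def codeg : ℕ := sInf {k : ℕ | 0 < k ∧
  ∃ z : Fin n → ℤ, (fun j => (z j : ℝ)) ∈ interior ((k : ℝ) • D.pts)}

end PolyDesc

/-- The face of `S` on which the linear functional `u` is maximized. -/
def argFace {n : ℕ} (S : Set (Fin n → ℝ)) (u : Fin n → ℝ) : Set (Fin n → ℝ) :=
  {x ∈ S | ∀ y ∈ S, ∑ j, u j * y j ≤ ∑ j, u j * x j}

/-- `S` and `T` have the same normal fan: two linear functionals lie in the same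
(relatively open) cone of the normal fan of `S`, i.e. are maximized on the same face
of `S`, iff the same holds for `T`. -/
def SameNormalFan {n : ℕ} (S T : Set (Fin n → ℝ)) : Prop :=
  ∀ u v : Fin n → ℝ, (argFace S u = argFace S v ↔ argFace T u = argFace T v)

/-- The normal fan of `S` refines the normal fan of `T`. -/
def RefinesNormalFan {n : ℕ} (S T : Set (Fin n → ℝ)) : Prop :=
  ∀ u v : Fin n → ℝ, argFace S u = argFace S v → argFace T u = argFace T v

namespace PolyDesc
variable {n m : ℕ} (D : PolyDesc n m)

/-- `{s > 0 : N(P⁽ˢ⁾) = N(P)}`, whose supremum is `τ(P)⁻¹`. -/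
def nefInvSet : Set ℝ := {s : ℝ | 0 < s ∧ SameNormalFan (D.adj s) D.pts}

/-- `τ(P)⁻¹ = sup {s > 0 : N(P⁽ˢ⁾) = N(P)}`. -/
def nefInv : ℝ := sSup D.nefInvSet

/-- The nef value `τ(P)`. -/
def nefVal : ℝ := D.nefInv⁻¹

/-- The set of inequalities active at `x`; the normal cone of the minimal face of `P`
containing `x` is generated by `{aᵢ : i ∈ active x}`, and all cones of the normal fan
of `P` arise in this way. -/
def active (x : Fin n → ℝ) : Set (Fin m) := {i | ipair (D.A i) x = (D.b i : ℝ)}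

/-- The normal cone at the vertex `v` is ℚ-Gorenstein of index `r`, witnessed by the
primitive lattice point `u = u_σ` with `⟨aᵢ, u⟩ = r` for all active `i`. -/
def VertexQG (v : Fin n → ℝ) (u : Fin n → ℤ) (r : ℤ) : Prop :=
  IsPrimitive u ∧ 0 < r ∧ ∀ i ∈ D.active v, (∑ j, D.A i j * u j) = r

/-- The normal fan of `P` is ℚ-Gorenstein: every maximal cone (normal cone of a
vertex, i.e. of an extreme point) is ℚ-Gorenstein. -/
def QGorenstein : Prop := ∀ v ∈ Set.extremePoints ℝ D.pts, ∃ u r, D.VertexQG v u r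

end PolyDesc

/-- The point `v(s) = v + (s/r_σ) • u_σ`. -/
def vmove {n : ℕ} (v : Fin n → ℝ) (s : ℝ) (u : Fin n → ℤ) (r : ℤ) : Fin n → ℝ :=
  v + (s / (r : ℝ)) • (fun j => ((u j : ℝ)))

/-- The height of a point `y` in the cone generated by `{aᵢ : i ∈ I}`:
`ht(y) = max {∑ λᵢ : λᵢ ≥ 0, ∑ λᵢ aᵢ = y}`. -/
def coneHeight {n m : ℕ} (D : PolyDesc n m) (I : Set (Fin m)) (y : Fin n → ℝ) : ℝ :=
  sSup {t : ℝ | ∃ c : Fin m → ℝ, (∀ i, 0 ≤ c i) ∧ (∀ i ∉ I, c i = 0) ∧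
    (y = ∑ i, c i • (fun j => ((D.A i j : ℝ)))) ∧ t = ∑ i, c i}

/-- `P` is α-canonical: for every cone `σ` of the normal fan of `P` (the normal cone
of the minimal face containing a point `x ∈ P`, generated by `{aᵢ : i ∈ active x}`),
every nonzero lattice point of `σ` has height at least `α`. -/
def AlphaCanonical {n m : ℕ} (D : PolyDesc n m) (α : ℝ) : Prop :=
  ∀ x ∈ D.pts, ∀ z : Fin n → ℤ, z ≠ 0 →
    (∃ c : Fin m → ℝ, (∀ i, 0 ≤ c i) ∧ (∀ i ∉ D.active x, c i = 0) ∧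
      ((fun j => ((z j : ℝ))) = ∑ i, c i • (fun j => ((D.A i j : ℝ))))) →
    α ≤ coneHeight D (D.active x) (fun j => ((z j : ℝ)))

/-- `P` is a lattice polytope: the convex hull of finitely many integer points. -/
def IsLatticePoly {n : ℕ} (P : Set (Fin n → ℝ)) : Prop :=
  ∃ V : Finset (Fin n → ℤ),
    P = convexHull ℝ ((fun z : Fin n → ℤ => fun j => ((z j : ℝ))) '' (V : Set (Fin n → ℤ)))

/-- The `i`-th standard basis vector of `ℝᵗ`. -/
def stdBasisVec (t : ℕ) (i : Fin t) : Fin t → ℝ := fun j => if j = i then 1 else 0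

/-- The marking vectors of a Cayley sum: `0, e₁, …, e_t ∈ ℝᵗ`. -/
def cayleyVec (t : ℕ) : Fin (t + 1) → (Fin t → ℝ) :=
  fun j => if h : (j : ℕ) = 0 then 0 else stdBasisVec t ⟨(j : ℕ) - 1, by have := j.isLt; omega⟩

/-- The Cayley sum `Q₀ * ⋯ * Q_t = conv((Q₀ × {0}) ∪ (Q₁ × {e₁}) ∪ ⋯ ∪ (Q_t × {e_t}))`. -/
def cayleySum {k t : ℕ} (Q : Fin (t + 1) → Set (Fin k → ℝ)) :
    Set ((Fin k → ℝ) × (Fin t → ℝ)) :=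
  convexHull ℝ (⋃ j, (Q j) ×ˢ ({cayleyVec t j} : Set (Fin t → ℝ)))

/-- `P ⊆ ℝⁿ` is a Cayley polytope `P₀ * ⋯ * P_t` of length `t+1` of lattice polytopes
`Pⱼ ⊆ ℝᵏ` with `k + t = n`: some affine lattice isomorphism `ℤⁿ ≅ ℤᵏ × ℤᵗ`
identifies `P` with such a Cayley sum. -/
def IsCayley {n : ℕ} (P : Set (Fin n → ℝ)) (k t : ℕ) : Prop :=
  k + t = n ∧
  ∃ Q : Fin (t + 1) → Finset (Fin k → ℤ), (∀ j, (Q j).Nonempty) ∧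
  ∃ f : (Fin n → ℝ) ≃ᵃ[ℝ] (Fin k → ℝ) × (Fin t → ℝ),
    f '' IntPts n = (IntPts k) ×ˢ (IntPts t) ∧
    f '' P = cayleySum (fun j =>
      convexHull ℝ ((fun z : Fin k → ℤ => fun i => ((z i : ℝ))) '' (Q j : Set (Fin k → ℤ))))

/-- The unimodular simplex `Δₙ = conv(0, e₁, …, eₙ)`. -/
def unimodSimplex (n : ℕ) : Set (Fin n → ℝ) :=
  convexHull ℝ (insert (0 : Fin n → ℝ) (Set.range (stdBasisVec n)))

/-- Two subsets of `ℝⁿ` are unimodularly equivalent: an affine lattice automorphism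
maps one onto the other. -/
def UnimodEquiv {n : ℕ} (P P' : Set (Fin n → ℝ)) : Prop :=
  ∃ f : (Fin n → ℝ) ≃ᵃ[ℝ] (Fin n → ℝ), f '' IntPts n = IntPts n ∧ f '' P = P'

/-- The codegree `cd(P) = min {k ∈ ℕ, k ≥ 1 : int(kP) ∩ ℤⁿ ≠ ∅}` of a polytope given
as a set. -/
def codegS {n : ℕ} (P : Set (Fin n → ℝ)) : ℕ :=
  sInf {k : ℕ | 0 < k ∧ ∃ z : Fin n → ℤ, (fun j => (z j : ℝ)) ∈ interior ((k : ℝ) • P)}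

/-- `P` has lattice width one: some nonzero integer linear functional has minimum `c`
and maximum `c + 1` on `P`. -/
def HasLatticeWidthOne {n : ℕ} (P : Set (Fin n → ℝ)) : Prop :=
  ∃ u : Fin n → ℤ, u ≠ 0 ∧ ∃ c : ℤ,
    (∀ x ∈ P, (c : ℝ) ≤ ipair u x ∧ ipair u x ≤ (c : ℝ) + 1) ∧
    (∃ x ∈ P, ipair u x = (c : ℝ)) ∧ (∃ x ∈ P, ipair u x = (c : ℝ) + 1)

/-- `P` is a lattice pyramid: for some primitive `u`, `P` is the convex hull of a base
lying in the lattice hyperplane `{⟨u, ·⟩ = c}` and an apex at lattice distance one from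
it (this is equivalent to being unimodularly equivalent to
`conv((Q × {0}) ∪ {(0, …, 0, 1)})` for an `(n-1)`-dimensional lattice polytope `Q`). -/
def IsLatticePyramid {n : ℕ} (P : Set (Fin n → ℝ)) : Prop :=
  ∃ u : Fin n → ℤ, IsPrimitive u ∧ ∃ c : ℤ, ∃ apex ∈ P,
    ipair u apex = (c : ℝ) + 1 ∧
    P = convexHull ℝ ({x ∈ P | ipair u x = (c : ℝ)} ∪ {apex})

/-- `F` is a facet of `S`: an exposed face of dimension `dim S - 1`. -/
def IsFacetOf {n : ℕ} (F S : Set (Fin n → ℝ)) : Prop :=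
  IsExposed ℝ S F ∧ F.Nonempty ∧ setDim F + 1 = setDim S

theorem ipair_add {n : ℕ} (a : Fin n → ℤ) (x y : Fin n → ℝ) :
    ipair a (x + y) = ipair a x + ipair a y := by
  simp [ipair, mul_add, Finset.sum_add_distrib]

theorem ipair_sub {n : ℕ} (a : Fin n → ℤ) (x y : Fin n → ℝ) :
    ipair a (x - y) = ipair a x - ipair a y := by
  simp [ipair, mul_sub, Finset.sum_sub_distrib]

theorem ipair_smul {n : ℕ} (a : Fin n → ℤ) (r : ℝ) (x : Fin n → ℝ) :
    ipair a (r • x) = r * ipair a x := by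
  simp [ipair, Finset.mul_sum, mul_left_comm]

theorem ipair_intCast {n : ℕ} (a z : Fin n → ℤ) :
    ipair a (fun j => (z j : ℝ)) = ((∑ j, a j * z j : ℤ) : ℝ) := by
  simp [ipair]

theorem continuous_ipair {n : ℕ} (a : Fin n → ℤ) : Continuous (ipair a) := by
  unfold ipair
  fun_prop

/-- The functional `ipair a` as a linear map. -/
def ipairLin {n : ℕ} (a : Fin n → ℤ) : (Fin n → ℝ) →ₗ[ℝ] ℝ where
  toFun := ipair a
  map_add' := ipair_add a
  map_smul' := ipair_smul a

@[simp]
theorem ipairLin_apply {n : ℕ} (a : Fin n → ℤ) (x : Fin n → ℝ) : ipairLin a x = ipair a x := rfl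

theorem ipair_single {n : ℕ} (a : Fin n → ℤ) (j : Fin n) : ipair a (Pi.single j 1) = a j := by
  simp [ipair, Pi.single_apply]

theorem ipair_self_pos {n : ℕ} {a : Fin n → ℤ} (ha : a ≠ 0) :
    0 < ipair a (fun j => (a j : ℝ)) := by
  obtain ⟨j, hj⟩ := Function.ne_iff.mp ha
  have hj' : (a j : ℝ) ≠ 0 := by exact_mod_cast hj
  exact Finset.sum_pos' (fun i _ => mul_self_nonneg _)
    ⟨j, Finset.mem_univ _, mul_self_pos.mpr hj'⟩

theorem finrank_ker_ipairLin {n : ℕ} {a : Fin n → ℤ} (ha : a ≠ 0) :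
    Module.finrank ℝ (LinearMap.ker (ipairLin a)) + 1 = n := by
  have hne : ipairLin a ≠ 0 := fun h => (ipair_self_pos ha).ne' (LinearMap.congr_fun h _)
  simpa using Module.Dual.finrank_ker_add_one_of_ne_zero hne

/-- If `ipair a` is constant on `S`, its kernel contains the direction space of `S`. -/
theorem vectorSpan_le_ker_ipairLin {n : ℕ} {a : Fin n → ℤ} {S : Set (Fin n → ℝ)} {c : ℝ}
    (h : ∀ x ∈ S, ipair a x = c) : vectorSpan ℝ S ≤ LinearMap.ker (ipairLin a) := by
  rw [vectorSpan_def, Submodule.span_le]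
  rintro _ ⟨x, hx, y, hy, rfl⟩
  simp [ipair_sub, h x hx, h y hy]

theorem setDim_empty {n : ℕ} : setDim (∅ : Set (Fin n → ℝ)) = 0 := by
  rw [setDim, vectorSpan_empty, finrank_bot]

/-- In a convex set on which finitely many affine inequalities hold, each of them strictly
somewhere, they all hold strictly at a common point. -/
theorem exists_forall_lt_of_convex {n m : ℕ} (A : Fin m → Fin n → ℤ) (b : Fin m → ℝ)
    {S : Set (Fin n → ℝ)} (hS : Convex ℝ S) (hne : S.Nonempty) (T : Finset (Fin m))
    (hle : ∀ x ∈ S, ∀ j, b j ≤ ipair (A j) x) (hlt : ∀ j ∈ T, ∃ x ∈ S, b j < ipair (A j) x) :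
    ∃ x ∈ S, ∀ j ∈ T, b j < ipair (A j) x := by
  classical
  induction T using Finset.induction_on with
  | empty => exact ⟨hne.some, hne.some_mem, by simp⟩
  | insert i T _ ih =>
    obtain ⟨x, hx, hxT⟩ := ih fun j hj => hlt j (Finset.mem_insert_of_mem hj)
    obtain ⟨y, hy, hyi⟩ := hlt i (Finset.mem_insert_self _ _)
    refine ⟨(1 / 2 : ℝ) • x + (1 / 2 : ℝ) • y,
      hS hx hy (by norm_num) (by norm_num) (by norm_num), fun j hj => ?_⟩
    rw [ipair_add, ipair_smul, ipair_smul]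
    rcases Finset.mem_insert.mp hj with rfl | hj
    · linarith [hle x hx j]
    · linarith [hle y hy j, hxT j hj]

/-- Finitely many affine functions, each positive, or nonnegative and nondecreasing, at `0`
are all nonnegative at some small positive parameter. -/
theorem exists_pos_forall_add_mul_nonneg {ι : Type*} [Finite ι] (α β : ι → ℝ)
    (h : ∀ j, 0 < α j ∨ (0 ≤ α j ∧ 0 ≤ β j)) : ∃ ε > 0, ∀ j, 0 ≤ α j + ε * β j := by
  have hev : ∀ᶠ ε in nhdsWithin (0 : ℝ) (Set.Ioi 0), 0 < ε ∧ ∀ j, 0 ≤ α j + ε * β j := by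
    refine Filter.Eventually.and self_mem_nhdsWithin (Filter.eventually_all.mpr fun j => ?_)
    rcases h j with hj | ⟨h0, h1⟩
    · have hc : Filter.Tendsto (fun ε : ℝ => α j + ε * β j) (nhdsWithin 0 (Set.Ioi 0))
          (nhds (α j + 0 * β j)) :=
        ((by fun_prop : Continuous fun ε : ℝ => α j + ε * β j).tendsto 0).mono_left
          nhdsWithin_le_nhds
      exact (hc.eventually (lt_mem_nhds (by simpa using hj))).mono fun _ hx => le_of_lt hx
    · filter_upwards [self_mem_nhdsWithin] with ε hε
      have : 0 ≤ ε * β j := mul_nonneg (le_of_lt hε) h1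
      linarith
  obtain ⟨ε, h0, h1⟩ := hev.exists
  exact ⟨ε, h0, h1⟩

/-- The entries of a primitive vector satisfy a Bézout identity. -/
theorem IsPrimitive.exists_sum_mul_eq_one {n : ℕ} {a : Fin n → ℤ} (ha : IsPrimitive a) :
    ∃ c : Fin n → ℤ, ∑ j, a j * c j = 1 := by
  obtain ⟨g, hg⟩ := IsPrincipalIdealRing.principal (Ideal.span (Set.range a))
  have hdvd : ∀ j, g ∣ a j := fun j => by
    have : a j ∈ Ideal.span (Set.range a) := Ideal.subset_span ⟨j, rfl⟩
    rw [hg] at this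
    exact Ideal.mem_span_singleton.mp this
  choose b hb using hdvd
  have hunit : IsUnit g := ha.2 g b (funext hb)
  have hone : (1 : ℤ) ∈ Ideal.span (Set.range a) := by
    rw [hg]
    exact Ideal.mem_span_singleton.mpr hunit.dvd
  obtain ⟨c, hc⟩ := Ideal.mem_span_range_iff_exists_fun.mp hone
  exact ⟨c, by simpa [mul_comm] using hc⟩

theorem IsPrimitive.eq_of_pos_smul {n : ℕ} {a a' : Fin n → ℤ} (ha : IsPrimitive a)
    (ha' : IsPrimitive a') {r : ℝ} (hr : 0 < r) (h : ∀ x, ipair a' x = r * ipair a x) :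
    r = 1 ∧ a' = a := by
  obtain ⟨c, hc⟩ := ha.exists_sum_mul_eq_one
  have hz : r = ((∑ j, a' j * c j : ℤ) : ℝ) := by
    have := h fun j => (c j : ℝ)
    rw [ipair_intCast, ipair_intCast, hc] at this
    simpa using this.symm
  set z : ℤ := ∑ j, a' j * c j
  have hsm : a' = z • a := by
    funext j
    have := h (Pi.single j 1)
    rw [ipair_single, ipair_single, hz] at this
    exact_mod_cast this
  have hz0 : 0 < z := by rw [hz] at hr; exact_mod_cast hr
  have hz1 : z = 1 := by
    rcases Int.isUnit_iff.mp (ha'.2 z a hsm) with h | h <;> omega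
  refine ⟨by rw [hz, hz1]; simp, by rw [hsm, hz1, one_smul]⟩

namespace PolyDesc
variable {n m : ℕ} (D : PolyDesc n m)

theorem one_le_dim (D : PolyDesc n m) : 1 ≤ n := by
  have := D.facet_dim ⟨0, D.hm⟩
  omega

theorem mem_pts {x : Fin n → ℝ} : x ∈ D.pts ↔ ∀ i, (D.b i : ℝ) ≤ ipair (D.A i) x := Iff.rfl

theorem mem_adj {s : ℝ} {x : Fin n → ℝ} :
    x ∈ D.adj s ↔ ∀ i, (D.b i : ℝ) + s ≤ ipair (D.A i) x := by
  simp [adj, dist, dF, Finset.le_inf'_iff, le_sub_iff_add_le, add_comm]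

theorem convex_pts : Convex ℝ D.pts := by
  intro x hx y hy r s hr hs hrs i
  rw [ipair_add, ipair_smul, ipair_smul]
  have h1 := mul_le_mul_of_nonneg_left (hx i) hr
  have h2 := mul_le_mul_of_nonneg_left (hy i) hs
  calc (D.b i : ℝ) = r * D.b i + s * D.b i := by rw [← add_mul, hrs, one_mul]
    _ ≤ _ := add_le_add h1 h2

theorem isClosed_adj (s : ℝ) : IsClosed (D.adj s) := by
  have : D.adj s = ⋂ i, {x | (D.b i : ℝ) + s ≤ ipair (D.A i) x} := by
    ext x
    simp [mem_adj]
  rw [this]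
  exact isClosed_iInter fun i => isClosed_le continuous_const (continuous_ipair _)

theorem adj_zero : D.adj 0 = D.pts := by
  ext x
  simp [mem_adj, mem_pts]

theorem isCompact_adj {s : ℝ} (hs : 0 ≤ s) : IsCompact (D.adj s) :=
  Metric.isCompact_of_isClosed_isBounded (D.isClosed_adj s)
    (D.bounded.subset fun x hx i => by linarith [D.mem_adj.mp hx i])

theorem isCompact_pts : IsCompact D.pts := D.adj_zero ▸ D.isCompact_adj le_rfl

theorem pts_nonempty : D.pts.Nonempty := by
  by_contra h
  have hd := D.fulldim
  rw [show {x : Fin n → ℝ | ∀ i, (D.b i : ℝ) ≤ ipair (D.A i) x} = ∅ from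
    Set.not_nonempty_iff_eq_empty.mp h] at hd
  have := D.one_le_dim
  rw [setDim_empty] at hd
  omega

theorem not_forall_ipair_eq {a : Fin n → ℤ} (ha : a ≠ 0) (c : ℝ) :
    ¬ ∀ x ∈ D.pts, ipair a x = c := by
  intro h
  have h1 := Submodule.finrank_mono (vectorSpan_le_ker_ipairLin h)
  have h2 := finrank_ker_ipairLin ha
  have h3 : Module.finrank ℝ (vectorSpan ℝ D.pts) = n := D.fulldim
  omega

theorem exists_forall_lt : ∃ x ∈ D.pts, ∀ i, (D.b i : ℝ) < ipair (D.A i) x := by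
  obtain ⟨x, hx, h⟩ := exists_forall_lt_of_convex D.A (fun i => (D.b i : ℝ)) D.convex_pts
    D.pts_nonempty Finset.univ (fun x hx => hx) fun j _ => by
      by_contra! h
      exact D.not_forall_ipair_eq (D.prim j).1 (D.b j) fun x hx => le_antisymm (h x hx) (hx j)
  exact ⟨x, hx, fun i => h i (Finset.mem_univ i)⟩

theorem facet_nonempty (hn : 2 ≤ n) (i : Fin m) : (D.facet i).Nonempty := by
  by_contra h
  have hd : setDim (D.facet i) + 1 = n := D.facet_dim i
  rw [Set.not_nonempty_iff_eq_empty.mp h] at hd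
  rw [setDim_empty] at hd
  omega

theorem convex_facet (i : Fin m) : Convex ℝ (D.facet i) := by
  refine D.convex_pts.inter ?_
  exact convex_hyperplane (f := ipair (D.A i)) (ipairLin (D.A i)).isLinear _

/-- Distinct facets are not contained in one another. -/
theorem exists_mem_facet_lt (hn : 2 ≤ n) {i j : Fin m} (hij : j ≠ i) :
    ∃ x ∈ D.facet i, (D.b j : ℝ) < ipair (D.A j) x := by
  by_contra! hle
  have heq : ∀ x ∈ D.facet i, ipair (D.A j) x = D.b j := fun x hx =>
    le_antisymm (hle x hx) (hx.1 j)
  have hi := vectorSpan_le_ker_ipairLin (S := D.facet i) (a := D.A i) (c := D.b i)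
    fun x hx => hx.2
  have hj := vectorSpan_le_ker_ipairLin heq
  have hdim : Module.finrank ℝ (vectorSpan ℝ (D.facet i)) + 1 = n := D.facet_dim i
  have hker : vectorSpan ℝ (D.facet i) = LinearMap.ker (ipairLin (D.A i)) :=
    Submodule.eq_of_le_of_finrank_eq hi (by have := finrank_ker_ipairLin (D.prim i).1; omega)
  have hmem : ipairLin (D.A j) ∈ Submodule.span ℝ (Set.range fun _ : Unit => ipairLin (D.A i)) := by
    refine mem_span_of_iInf_ker_le_ker ?_
    simpa [← hker] using hj
  simp only [Set.range_const, Submodule.mem_span_singleton] at hmem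
  obtain ⟨r, hr⟩ := hmem
  have hr' : ∀ x, ipair (D.A j) x = r * ipair (D.A i) x := fun x =>
    (LinearMap.congr_fun hr x).symm
  obtain ⟨p, hp⟩ := D.facet_nonempty hn i
  obtain ⟨q, hq, hqlt⟩ := D.exists_forall_lt
  have hbj : (D.b j : ℝ) = r * D.b i := by rw [← heq p hp, hr', hp.2]
  have hpos : 0 < r := by
    have h1 := hqlt i
    have h2 := hqlt j
    rw [hr', hbj] at h2
    by_contra! h
    nlinarith
  obtain ⟨h1, hA⟩ := (D.prim i).eq_of_pos_smul (D.prim j) hpos hr'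
  rw [h1, one_mul] at hbj
  exact hij (D.irredundant (Prod.ext hA (by exact_mod_cast hbj)))

theorem exists_mem_facet_forall_lt (hn : 2 ≤ n) (i : Fin m) :
    ∃ x ∈ D.facet i, ∀ j ≠ i, (D.b j : ℝ) < ipair (D.A j) x := by
  obtain ⟨x, hx, h⟩ := exists_forall_lt_of_convex D.A (fun i => (D.b i : ℝ)) (D.convex_facet i)
    (D.facet_nonempty hn i) (Finset.univ.erase i) (fun x hx => hx.1) fun j hj =>
      D.exists_mem_facet_lt hn (Finset.ne_of_mem_erase hj)
  exact ⟨x, hx, fun j hj => h j (Finset.mem_erase.mpr ⟨hj, Finset.mem_univ j⟩)⟩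

/-- The facet normals active at a vertex span the dual space. -/
theorem eq_zero_of_forall_active {v z : Fin n → ℝ} (hv : v ∈ Set.extremePoints ℝ D.pts)
    (hz : ∀ i ∈ D.active v, ipair (D.A i) z = 0) : z = 0 := by
  have key : ∀ w : Fin n → ℝ, (∀ i ∈ D.active v, ipair (D.A i) w = 0) →
      ∀ i, 0 < ipair (D.A i) v - D.b i ∨ 0 ≤ ipair (D.A i) v - D.b i ∧ 0 ≤ ipair (D.A i) w := by
    intro w hw i
    rcases (hv.1 i).lt_or_eq with h | h
    · exact Or.inl (sub_pos.mpr h)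
    · exact Or.inr ⟨(sub_nonneg.mpr h.le), (hw i h.symm).ge⟩
  have hneg : ∀ i ∈ D.active v, ipair (D.A i) (-z) = 0 := fun i hi => by
    rw [← neg_one_smul ℝ z, ipair_smul, hz i hi, mul_zero]
  obtain ⟨ε, hε, h1⟩ := exists_pos_forall_add_mul_nonneg _ _ (key z hz)
  obtain ⟨δ, hδ, h2⟩ := exists_pos_forall_add_mul_nonneg _ _ (key (-z) hneg)
  have hx : v + ε • z ∈ D.pts := fun i => by
    rw [ipair_add, ipair_smul]; linarith [h1 i]
  have hy : v + δ • -z ∈ D.pts := fun i => by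
    rw [ipair_add, ipair_smul]; linarith [h2 i]
  have hseg : v ∈ openSegment ℝ (v + ε • z) (v + δ • -z) := by
    refine ⟨δ / (ε + δ), ε / (ε + δ), by positivity, by positivity, by field_simp; ring, ?_⟩
    ext j
    simp
    field_simp
    ring
  have := hv.2 hx hy hseg
  simpa [hε.ne'] using this

end PolyDesc

theorem le_of_forall_add_mul_le {α β γ δ : ℝ} (h : ∀ t : ℝ, 0 ≤ t → α + t * β ≤ γ + t * δ) :
    β ≤ δ := by
  by_contra! hlt
  have hpos : 0 < β - δ := sub_pos.mpr hlt
  have := h ((|γ - α| + 1) / (β - δ)) (by positivity)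
  have h2 : (|γ - α| + 1) / (β - δ) * (β - δ) = |γ - α| + 1 := div_mul_cancel₀ _ hpos.ne'
  nlinarith [le_abs_self (γ - α)]

namespace PolyDesc
variable {n m : ℕ} (D : PolyDesc n m)

/-- The functional `-∑_{k ∈ I} aₖ - t aⱼ`. -/
def coneFun (I : Finset (Fin m)) (j : Fin m) (t : ℝ) : Fin n → ℝ :=
  fun l => -(∑ k ∈ I, (D.A k l : ℝ)) - t * D.A j l

theorem sum_coneFun_mul (I : Finset (Fin m)) (j : Fin m) (t : ℝ) (x : Fin n → ℝ) :
    ∑ l, D.coneFun I j t l * x l = -(∑ k ∈ I, ipair (D.A k) x + t * ipair (D.A j) x) := by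
  simp only [coneFun, ipair, sub_mul, neg_mul, Finset.sum_sub_distrib, Finset.sum_neg_distrib,
    Finset.sum_mul, Finset.mul_sum, mul_assoc]
  rw [Finset.sum_comm]
  ring

theorem mem_argFace_coneFun {S : Set (Fin n → ℝ)} {I : Finset (Fin m)} {j : Fin m} {t : ℝ}
    {x : Fin n → ℝ} : x ∈ argFace S (D.coneFun I j t) ↔ x ∈ S ∧ ∀ y ∈ S,
      ∑ k ∈ I, ipair (D.A k) x + t * ipair (D.A j) x ≤
        ∑ k ∈ I, ipair (D.A k) y + t * ipair (D.A j) y := by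
  simp only [argFace, sum_coneFun_mul, neg_le_neg_iff, Set.mem_ofPred_eq]

/-- A point is determined by a vertex `v` once the functionals active at `v` dominate. -/
theorem eq_of_forall_active_le {v x y : Fin n → ℝ} (hv : v ∈ Set.extremePoints ℝ D.pts)
    {I : Finset (Fin m)} (hI : ∀ i, i ∈ I ↔ i ∈ D.active v)
    (hle : ∀ i ∈ I, ipair (D.A i) x ≤ ipair (D.A i) y)
    (hsum : ∑ i ∈ I, ipair (D.A i) y ≤ ∑ i ∈ I, ipair (D.A i) x) : y = x := by
  have heq := (Finset.sum_eq_sum_iff_of_le hle).mp (le_antisymm (Finset.sum_le_sum hle) hsum)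
  refine sub_eq_zero.mp (D.eq_zero_of_forall_active hv fun i hi => ?_)
  rw [ipair_sub, heq i ((hI i).mpr hi), sub_self]

theorem argFace_pts_coneFun {v : Fin n → ℝ} (hv : v ∈ Set.extremePoints ℝ D.pts)
    {I : Finset (Fin m)} (hI : ∀ i, i ∈ I ↔ i ∈ D.active v) {i : Fin m} (hi : i ∈ I) {t : ℝ}
    (ht : 0 ≤ t) : argFace D.pts (D.coneFun I i t) = {v} := by
  have hact : ∀ k ∈ I, ∀ y ∈ D.pts, ipair (D.A k) v ≤ ipair (D.A k) y := fun k hk y hy =>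
    ((hI k).mp hk).le.trans (hy k)
  ext y
  rw [mem_argFace_coneFun, Set.mem_singleton_iff]
  constructor
  · rintro ⟨hy, h⟩
    have h1 := h v hv.1
    have h2 := mul_le_mul_of_nonneg_left (hact i hi y hy) ht
    exact D.eq_of_forall_active_le hv hI (fun k hk => hact k hk y hy) (by linarith)
  · rintro rfl
    exact ⟨hv.1, fun y hy => add_le_add (Finset.sum_le_sum fun k hk => hact k hk y hy)
      (mul_le_mul_of_nonneg_left (hact i hi y hy) ht)⟩

theorem active_nonempty {v : Fin n → ℝ} (hv : v ∈ Set.extremePoints ℝ D.pts) :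
    (D.active v).Nonempty := by
  by_contra h
  rw [Set.not_nonempty_iff_eq_empty] at h
  have := D.eq_zero_of_forall_active (z := fun _ => 1) hv (by simp [h])
  exact one_ne_zero (congr_fun this ⟨0, D.one_le_dim⟩)

theorem adj_nonempty_of_sameNormalFan {s : ℝ} (hfan : SameNormalFan (D.adj s) D.pts) :
    (D.adj s).Nonempty := by
  classical
  by_contra h
  rw [Set.not_nonempty_iff_eq_empty] at h
  obtain ⟨v, hv⟩ := D.isCompact_pts.extremePoints_nonempty D.pts_nonempty
  obtain ⟨i, hi⟩ := D.active_nonempty hv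
  have hI : ∀ i, i ∈ (D.active v).toFinset ↔ i ∈ D.active v := fun i => Set.mem_toFinset
  have h1 := D.argFace_pts_coneFun hv hI ((hI i).mpr hi) le_rfl
  have h2 : argFace D.pts (D.coneFun (D.active v).toFinset i 0) = argFace D.pts 0 :=
    (hfan _ _).mp (by simp [argFace, h])
  have h3 : argFace D.pts 0 = D.pts := by simp [argFace]
  have hP : D.pts = {v} := by rw [← h3, ← h2, h1]
  exact D.not_forall_ipair_eq (D.prim i).1 (ipair (D.A i) v) fun x hx => by
    rw [hP] at hx; rw [hx]

/-- If the adjoint polytope `P⁽ˢ⁾` has the normal fan of `P` and `u` has value one on the facet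
normals active at the vertex `v`, then `v + s u` lies in `P⁽ˢ⁾`. -/
theorem vertex_add_smul_mem_adj (hn : 2 ≤ n) {s : ℝ} (hs : 0 ≤ s)
    (hfan : SameNormalFan (D.adj s) D.pts) {v : Fin n → ℝ}
    (hv : v ∈ Set.extremePoints ℝ D.pts) {u : Fin n → ℝ}
    (hu : ∀ i ∈ D.active v, ipair (D.A i) u = 1) : v + s • u ∈ D.adj s := by
  classical
  set I := (D.active v).toFinset with hIdef
  have hI : ∀ i, i ∈ I ↔ i ∈ D.active v := fun i => Set.mem_toFinset
  obtain ⟨i₀, hi₀⟩ := D.active_nonempty hv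
  have hi₀' := (hI i₀).mpr hi₀
  obtain ⟨x, hxadj, hxmin⟩ := (D.isCompact_adj hs).exists_isMinOn
    (D.adj_nonempty_of_sameNormalFan hfan)
    (continuous_finsetSum I fun k _ => continuous_ipair (D.A k)).continuousOn
  have hxface : x ∈ argFace (D.adj s) (D.coneFun I i₀ 0) := by
    rw [mem_argFace_coneFun]
    exact ⟨hxadj, fun y hy => by simpa using hxmin hy⟩
  have hmin : ∀ i ∈ I, ∀ y ∈ D.adj s, ipair (D.A i) x ≤ ipair (D.A i) y := by
    intro i hi y hy
    refine le_of_forall_add_mul_le (α := ∑ k ∈ I, ipair (D.A k) x)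
      (γ := ∑ k ∈ I, ipair (D.A k) y) fun t ht => ?_
    have heq : argFace (D.adj s) (D.coneFun I i₀ 0) = argFace (D.adj s) (D.coneFun I i t) :=
      (hfan _ _).mpr (by
        rw [D.argFace_pts_coneFun hv hI hi₀' le_rfl, D.argFace_pts_coneFun hv hI hi ht])
    rw [heq, mem_argFace_coneFun] at hxface
    exact hxface.2 y hy
  have hsingle : ∀ j, (D.b j : ℝ) + s = ipair (D.A j) x → ∀ t, 0 ≤ t →
      argFace (D.adj s) (D.coneFun I j t) = argFace (D.adj s) (D.coneFun I i₀ 0) := by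
    intro j hj t ht
    ext y
    rw [mem_argFace_coneFun, mem_argFace_coneFun]
    constructor
    · rintro ⟨hy, h⟩
      have h1 := h x hxadj
      have h2 := mul_le_mul_of_nonneg_left (hj.symm.le.trans (D.mem_adj.mp hy j)) ht
      rw [D.eq_of_forall_active_le (x := x) hv hI (fun k hk => hmin k hk y hy) (by linarith)]
      exact D.mem_argFace_coneFun.mp hxface
    · rintro ⟨hy, h⟩
      have h1 := h x hxadj
      rw [D.eq_of_forall_active_le (x := x) hv hI (fun k hk => hmin k hk y hy) (by linarith)]
      exact ⟨hxadj, fun w hw => add_le_add (hxmin hw)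
        (mul_le_mul_of_nonneg_left (hj.symm.le.trans (D.mem_adj.mp hw j)) ht)⟩
  have htight : ∀ j, (D.b j : ℝ) + s = ipair (D.A j) x → ipair (D.A j) v = D.b j := by
    intro j hj
    obtain ⟨p, hp⟩ := D.facet_nonempty hn j
    refine le_antisymm ?_ (hv.1 j)
    rw [← hp.2]
    refine le_of_forall_add_mul_le (α := ∑ k ∈ I, ipair (D.A k) v)
      (γ := ∑ k ∈ I, ipair (D.A k) p) fun t ht => ?_
    have heq := (hfan _ _).mp (hsingle j hj t ht)
    have hvmem : v ∈ argFace D.pts (D.coneFun I j t) := by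
      rw [heq, D.argFace_pts_coneFun hv hI hi₀' le_rfl]; rfl
    exact (D.mem_argFace_coneFun.mp hvmem).2 p hp.1
  have hactive : ∀ i ∈ I, ipair (D.A i) x = D.b i + s := by
    intro i hi
    by_contra hne
    obtain ⟨p, hp, hplt⟩ := D.exists_mem_facet_forall_lt hn i
    set a : Fin n → ℝ := fun l => (D.A i l : ℝ)
    have hiv : ipair (D.A i) v = D.b i := (hI i).mp hi
    obtain ⟨δ, hδ, hδ'⟩ := exists_pos_forall_add_mul_nonneg (ι := {j // j ≠ i})
      (fun j => ipair (D.A j) p - D.b j) (fun j => -ipair (D.A j) a)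
      fun j => Or.inl (sub_pos.mpr (hplt j j.2))
    obtain ⟨ε, hε, hε'⟩ := exists_pos_forall_add_mul_nonneg
      (fun j => ipair (D.A j) x - (D.b j + s)) (fun j => ipair (D.A j) (p - v - δ • a)) fun j => by
        rcases (D.mem_adj.mp hxadj j).lt_or_eq with h | h
        · exact Or.inl (sub_pos.mpr h)
        · have hji : j ≠ i := by rintro rfl; exact hne h.symm
          refine Or.inr ⟨(sub_nonneg.mpr h.le), ?_⟩
          rw [ipair_sub, ipair_sub, ipair_smul, htight j h]
          linarith [hδ' ⟨j, hji⟩]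
    have hmem : x + ε • (p - v - δ • a) ∈ D.adj s := D.mem_adj.mpr fun j => by
      rw [ipair_add, ipair_smul]; linarith [hε' j]
    have h1 := hmin i hi _ hmem
    rw [ipair_add, ipair_smul, ipair_sub, ipair_sub, ipair_smul, hp.2, hiv] at h1
    have h2 : 0 < ε * (δ * ipair (D.A i) a) :=
      mul_pos hε (mul_pos hδ (ipair_self_pos (D.prim i).1))
    linarith
  have hx : x - (v + s • u) = 0 := D.eq_zero_of_forall_active hv fun i hi => by
    rw [ipair_sub, ipair_add, ipair_smul, hu i hi, hactive i ((hI i).mpr hi), show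
      ipair (D.A i) v = D.b i from hi]
    ring
  rwa [← sub_eq_zero.mp hx]

theorem bddAbove_qcdInvSet : BddAbove D.qcdInvSet := by
  obtain ⟨M, hM⟩ := (D.isCompact_pts.image (continuous_ipair (D.A ⟨0, D.hm⟩))).bddAbove
  refine ⟨M - D.b ⟨0, D.hm⟩, ?_⟩
  rintro s ⟨hs, x, hx⟩
  have h1 := D.mem_adj.mp hx
  have h2 : ipair (D.A ⟨0, D.hm⟩) x ≤ M :=
    hM ⟨x, fun i => by linarith [h1 i], rfl⟩
  linarith [h1 ⟨0, D.hm⟩]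

theorem qcdInv_pos : 0 < D.qcdInv := by
  obtain ⟨x, -, hx⟩ := D.exists_forall_lt
  obtain ⟨s, hs, h⟩ := exists_pos_forall_add_mul_nonneg
    (fun i => ipair (D.A i) x - D.b i) (fun _ => -1) fun i => Or.inl (sub_pos.mpr (hx i))
  have hmem : s ∈ D.qcdInvSet := ⟨hs, x, D.mem_adj.mpr fun i => by linarith [h i]⟩
  exact hs.trans_le (le_csSup D.bddAbove_qcdInvSet hmem)

/-- For a `ℚ`-normal lattice polytope with Gorenstein normal fan, `μ(P) > cd(P) - 1`. -/
theorem qcdInv_lt_inv_of_lt_codeg (hn : 2 ≤ n) (hlat : IsLatticePoly D.pts)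
    (hGor : ∀ v ∈ Set.extremePoints ℝ D.pts, ∃ u : Fin n → ℤ, D.VertexQG v u 1)
    (hQN : D.qcd = D.nefVal) {c : ℕ} (hc : 0 < c) (hcd : c < D.codeg) :
    D.qcdInv < (c : ℝ)⁻¹ := by
  by_contra! hle
  obtain ⟨v, hv⟩ := D.isCompact_pts.extremePoints_nonempty D.pts_nonempty
  obtain ⟨u, -, -, hu⟩ := hGor v hv
  obtain ⟨V, hV⟩ := hlat
  obtain ⟨w, -, hw⟩ := extremePoints_convexHull_subset (hV ▸ hv)
  have hu' : ∀ i ∈ D.active v, ipair (D.A i) (fun j => (u j : ℝ)) = 1 := fun i hi => by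
    rw [ipair_intCast, hu i hi, Int.cast_one]
  have hnef : D.nefInv = D.qcdInv := (inv_injective hQN).symm
  have hne : D.nefInvSet.Nonempty := by
    by_contra h
    have h0 := D.qcdInv_pos
    rw [← hnef, nefInv, Set.not_nonempty_iff_eq_empty.mp h, Real.sSup_empty] at h0
    exact h0.false
  have hc' : (0 : ℝ) < c := by exact_mod_cast hc
  have hmem : ∀ i, (D.b i : ℝ) + (c : ℝ)⁻¹ ≤
      ipair (D.A i) v + (c : ℝ)⁻¹ * ipair (D.A i) (fun j => (u j : ℝ)) := by
    intro i
    by_contra! hlt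
    have hvi := hv.1 i
    set e := ipair (D.A i) (fun j => (u j : ℝ)) with he
    have hcpos : 0 < (c : ℝ)⁻¹ := inv_pos.mpr hc'
    have hk : 0 < 1 - e := by
      by_contra! h
      nlinarith
    have hs₀ : (ipair (D.A i) v - D.b i) / (1 - e) < sSup D.nefInvSet := by
      refine lt_of_lt_of_le ?_ (hle.trans hnef.ge)
      rw [div_lt_iff₀ hk]
      linarith
    obtain ⟨s, ⟨hs, hfan⟩, hlts⟩ := exists_lt_of_lt_csSup hne hs₀
    rw [div_lt_iff₀ hk] at hlts
    have := D.mem_adj.mp (D.vertex_add_smul_mem_adj hn hs.le hfan hv hu') i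
    rw [ipair_add, ipair_smul, ← he] at this
    linarith
  refine Nat.notMem_of_lt_sInf hcd ⟨hc, fun j => (c : ℤ) * w j + u j, ?_⟩
  have hz : (fun j => (((c : ℤ) * w j + u j : ℤ) : ℝ)) = (c : ℝ) • v + fun j => (u j : ℝ) := by
    rw [← hw]
    ext j
    simp
  rw [hz]
  have hopen : IsOpen {y : Fin n → ℝ | ∀ i, (c : ℝ) * D.b i < ipair (D.A i) y} := by
    simp only [Set.ofPred_forall]
    exact isOpen_iInter_of_finite fun i => isOpen_lt continuous_const (continuous_ipair _)
  refine interior_maximal ?_ hopen ?_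
  · intro y hy
    rw [Set.mem_smul_set_iff_inv_smul_mem₀ hc'.ne']
    intro i
    rw [ipair_smul, inv_mul_eq_div, le_div_iff₀ hc', mul_comm]
    exact (hy i).le
  · intro i
    rw [ipair_add, ipair_smul]
    have := mul_le_mul_of_nonneg_left (hmem i) hc'.le
    rw [mul_add, mul_add, mul_inv_cancel₀ hc'.ne', ← mul_assoc, mul_inv_cancel₀ hc'.ne'] at this
    linarith

end PolyDesc

namespace PolyDesc
variable {n m : ℕ} (D : PolyDesc n m)

/-- Linear programming duality for an empty adjoint polytope. -/
theorem exists_weights_of_adj_eq_empty {s : ℝ} (hs : 0 < s) (hempty : D.adj s = ∅) :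
    ∃ c : Fin m → ℝ, (∀ i, 0 ≤ c i) ∧ (∀ x, ∑ i, c i * D.dF i x = 1) ∧ s⁻¹ ≤ ∑ i, c i := by
  classical
  let p : Fin m → (Fin n → ℝ) × ℝ := fun i => (fun j => (D.A i j : ℝ), -(D.b i : ℝ))
  let L : (Fin m → ℝ) →ₗ[ℝ] (Fin n → ℝ) × ℝ := Fintype.linearCombination ℝ p
  have hLcont : Continuous L := L.continuous_of_finiteDimensional
  let S : Set ((Fin n → ℝ) × ℝ) := {q | q.1 = 0 ∧ q.2 ≤ s}
  have hSclosed : IsClosed S :=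
    (isClosed_eq continuous_fst continuous_const).inter (isClosed_le continuous_snd continuous_const)
  have hSconv : Convex ℝ S := by
    rintro ⟨x, r⟩ ⟨hx, hr⟩ ⟨y, t⟩ ⟨hy, ht⟩ α β hα hβ hαβ
    simp only at hx hr hy ht
    refine ⟨by simp [hx, hy], ?_⟩
    simp only [Prod.smul_mk, Prod.mk_add_mk, smul_eq_mul]
    nlinarith
  have hmeet : ¬ Disjoint (L '' stdSimplex ℝ (Fin m)) S := by
    intro hdisj
    obtain ⟨φ, r, r', hlt, hrr, hgt⟩ := geometric_hahn_banach_compact_closed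
      ((convex_stdSimplex ℝ (Fin m)).linear_image L) ((isCompact_stdSimplex ℝ (Fin m)).image hLcont)
      hSconv hSclosed hdisj
    set y : Fin n → ℝ := fun j => φ (Pi.single j 1, 0) with hy
    set α : ℝ := φ (0, 1) with hα
    have hφ : ∀ i, φ (p i) = ipair (D.A i) y - D.b i * α := by
      intro i
      have : p i = ∑ j, (D.A i j : ℝ) • ((Pi.single j 1, 0) : (Fin n → ℝ) × ℝ)
          + (-(D.b i : ℝ)) • (0, 1) := by
        ext k <;> simp [p, Prod.fst_sum, Prod.snd_sum, Finset.sum_apply, Pi.single_apply]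
      rw [this, map_add, map_sum, map_smul]
      simp_rw [map_smul]
      simp only [ipair, hy, hα, smul_eq_mul]
      ring
    have hp : ∀ i, ipair (D.A i) y - D.b i * α < r := fun i => by
      rw [← hφ]
      refine hlt _ ⟨Pi.single i 1, single_mem_stdSimplex ℝ i, ?_⟩
      simp [L, Fintype.linearCombination_apply_single]
    have hray : ∀ h ≤ s, r' < h * α := fun h hh => by
      have := hgt (0, h) ⟨rfl, hh⟩
      rwa [show ((0, h) : (Fin n → ℝ) × ℝ) = h • (0, 1) by simp, map_smul, smul_eq_mul] at this
    have hα0 : α ≤ 0 := by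
      by_contra! hpos
      have := hray (min s (r' / α)) (min_le_left _ _)
      have h2 : min s (r' / α) * α ≤ r' / α * α :=
        mul_le_mul_of_nonneg_right (min_le_right _ _) hpos.le
      rw [div_mul_cancel₀ _ hpos.ne'] at h2
      linarith
    have hrs := hray s le_rfl
    rcases hα0.lt_or_eq with hneg | hzero
    · have hmem : α⁻¹ • y ∈ D.adj s := D.mem_adj.mpr fun i => by
        rw [ipair_smul, inv_mul_eq_div, le_div_iff_of_neg hneg]
        linarith [hp i]
      simp [hempty] at hmem
    · obtain ⟨x, hx, -⟩ := D.exists_forall_lt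
      have hyneg : ∀ i, ipair (D.A i) y < 0 := fun i => by
        have := hp i
        rw [hzero] at this hrs
        linarith
      obtain ⟨ε, hε, h⟩ := exists_pos_forall_add_mul_nonneg
        (fun i => -ipair (D.A i) y) (fun _ => -s) fun i => Or.inl (neg_pos.mpr (hyneg i))
      have hmem : x + (-ε⁻¹) • y ∈ D.adj s := D.mem_adj.mpr fun i => by
        rw [ipair_add, ipair_smul]
        have h1 : s ≤ ε⁻¹ * -ipair (D.A i) y := by
          rw [inv_mul_eq_div, le_div_iff₀ hε]
          linarith [h i]
        linarith [hx i]
      simp [hempty] at hmem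
  obtain ⟨_, ⟨w, ⟨hw0, hw1⟩, rfl⟩, hz, hh⟩ := Set.not_disjoint_iff.mp hmeet
  have hL : L w = ∑ i, w i • p i := Fintype.linearCombination_apply ..
  have hd : ∀ x, ∑ i, w i * D.dF i x = (L w).2 := by
    intro x
    have h1 : ∑ i, w i * ipair (D.A i) x = 0 := by
      calc ∑ i, w i * ipair (D.A i) x = ∑ j, (L w).1 j * x j := by
            simp only [ipair, hL, Prod.fst_sum, Finset.sum_apply, Finset.mul_sum, Finset.sum_mul]
            rw [Finset.sum_comm]
            simp [p, mul_assoc]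
        _ = 0 := by simp [hz]
    simp only [dF, mul_sub, Finset.sum_sub_distrib, h1]
    simp [hL, Prod.snd_sum, p]
  obtain ⟨x, -, hx⟩ := D.exists_forall_lt
  have hpos : 0 < (L w).2 := by
    rw [← hd x]
    have hex : ∃ i, 0 < w i := by
      by_contra! h
      have : ∑ i, w i ≤ 0 := Finset.sum_nonpos fun i _ => h i
      linarith
    obtain ⟨i, hi⟩ := hex
    exact Finset.sum_pos' (fun j _ => mul_nonneg (hw0 j) (sub_pos.mpr (hx j)).le)
      ⟨i, Finset.mem_univ i, mul_pos hi (sub_pos.mpr (hx i))⟩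
  refine ⟨fun i => (L w).2⁻¹ * w i, fun i => mul_nonneg (inv_nonneg.mpr hpos.le) (hw0 i),
    fun x => ?_, ?_⟩
  · simp_rw [mul_assoc]
    rw [← Finset.mul_sum, hd, inv_mul_cancel₀ hpos.ne']
  · rw [← Finset.mul_sum, hw1, mul_one]
    exact inv_anti₀ hpos hh

/-- The weights `c` express the constant function `1` on `P` as a nonnegative combination of the
facet distances, with total weight exceeding `q`. -/
structure IsWeight (q : ℝ) (c : Fin m → ℝ) : Prop where
  nonneg : ∀ i, 0 ≤ c i
  sum_mul : ∀ x ∈ D.pts, ∑ i, c i * D.dF i x = 1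
  lt_sum : q < ∑ i, c i

variable {D}

/-- A relation among the facet distances on the support of a weight can be used to shrink that
support. -/
theorem IsWeight.exists_support_ssubset {q : ℝ} {c e : Fin m → ℝ} (hc : D.IsWeight q c)
    (he : ∀ i, c i = 0 → e i = 0) (hrel : ∀ x ∈ D.pts, ∑ i, e i * D.dF i x = 0)
    (hsum : 0 ≤ ∑ i, e i) (hne : e ≠ 0) :
    ∃ c', D.IsWeight q c' ∧ Function.support c' ⊂ Function.support c := by
  have hneg : ∃ i, e i < 0 := by
    by_contra! h
    obtain ⟨i, hi⟩ := Function.ne_iff.mp hne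
    obtain ⟨x, hx, hlt⟩ := D.exists_forall_lt
    have : 0 < ∑ i, e i * D.dF i x :=
      Finset.sum_pos' (fun j _ => mul_nonneg (h j) (sub_pos.mpr (hlt j)).le)
        ⟨i, Finset.mem_univ i, mul_pos ((h i).lt_of_ne' hi) (sub_pos.mpr (hlt i))⟩
    exact this.ne' (hrel x hx)
  obtain ⟨i₀, hi₀⟩ := hneg
  obtain ⟨i, hi, hmin⟩ := Finset.exists_min_image (Finset.univ.filter fun i => e i < 0)
    (fun i => c i / -e i) ⟨i₀, by simpa using hi₀⟩
  simp only [Finset.mem_filter, Finset.mem_univ, true_and] at hi hmin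
  set t := c i / -e i with ht
  have ht0 : 0 ≤ t := div_nonneg (hc.nonneg i) (by linarith)
  have hci : c i + t * e i = 0 := by
    rw [ht, div_neg, neg_mul, div_mul_cancel₀ _ hi.ne, add_neg_cancel]
  refine ⟨fun j => c j + t * e j, ⟨fun j => ?_, fun x hx => ?_, ?_⟩, ?_⟩
  · rcases lt_or_ge (e j) 0 with hj | hj
    · have := hmin j hj
      rw [le_div_iff₀ (by linarith)] at this
      linarith
    · exact add_nonneg (hc.nonneg j) (mul_nonneg ht0 hj)
  · simp_rw [add_mul, mul_assoc]
    rw [Finset.sum_add_distrib, ← Finset.mul_sum, hc.sum_mul x hx, hrel x hx, mul_zero, add_zero]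
  · rw [Finset.sum_add_distrib, ← Finset.mul_sum]
    have := mul_nonneg ht0 hsum
    linarith [hc.lt_sum]
  · refine (Set.ssubset_iff_of_subset ?_).mpr ⟨i, fun h => hi.ne (he i h), fun h => h hci⟩
    intro j hj hcj
    exact hj (by simp [hcj, he j hcj])

/-- If some weight exists, then there is one on whose support the facet distances are linearly
independent. -/
theorem IsWeight.exists_independent {q : ℝ} {c : Fin m → ℝ} (hc : D.IsWeight q c) :
    ∃ c', D.IsWeight q c' ∧ ∀ e : Fin m → ℝ, (∀ i, c' i = 0 → e i = 0) →
      (∀ x ∈ D.pts, ∑ i, e i * D.dF i x = 0) → e = 0 := by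
  obtain ⟨c', hc', hmin⟩ := exists_minimal_of_wellFoundedLT
    (fun s : Set (Fin m) => ∃ c, D.IsWeight q c ∧ Function.support c = s) ⟨_, c, hc, rfl⟩
  obtain ⟨c', hw, rfl⟩ := hc'
  refine ⟨c', hw, fun e he hrel => ?_⟩
  by_contra hne
  have hno : ¬ ∃ d, D.IsWeight q d ∧ Function.support d ⊂ Function.support c' := by
    rintro ⟨d, hd, hss⟩
    exact hss.2 (hmin ⟨d, hd, rfl⟩ hss.1)
  rcases le_total 0 (∑ i, e i) with h | h
  · exact hno (hw.exists_support_ssubset he hrel h hne)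
  · refine hno (hw.exists_support_ssubset (e := -e) (fun i hi => by simp [he i hi])
      (fun x hx => ?_) ?_ (neg_ne_zero.mpr hne))
    · simp [hrel x hx]
    · simpa using h

/-- Linearly independent facet distances number at most `n + 1`. -/
theorem card_le_of_independent {T : Finset (Fin m)}
    (h : ∀ e : Fin m → ℝ, (∀ i ∉ T, e i = 0) → (∀ x ∈ D.pts, ∑ i, e i * D.dF i x = 0) → e = 0) :
    T.card ≤ n + 1 := by
  classical
  let p : Fin m → (Fin n → ℝ) × ℝ := fun i => (fun j => (D.A i j : ℝ), -(D.b i : ℝ))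
  have hli : LinearIndependent ℝ fun i : T => p i := by
    rw [Fintype.linearIndependent_iff]
    intro g hg
    let e : Fin m → ℝ := fun i => if hi : i ∈ T then g ⟨i, hi⟩ else 0
    have hsum : ∑ i, e i • p i = 0 := by
      rw [← hg, ← Finset.sum_subset (Finset.subset_univ T) fun i _ hi => by simp [e, hi],
        ← Finset.sum_coe_sort]
      exact Finset.sum_congr rfl fun i _ => by simp [e]
    have he : e = 0 := h e (fun i hi => by simp [e, hi]) fun x _ => by
      have h1 : ∑ i, e i * ipair (D.A i) x = 0 := by
        calc ∑ i, e i * ipair (D.A i) x = ∑ j, (∑ i, e i • p i).1 j * x j := by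
              simp only [ipair, Prod.fst_sum, Finset.sum_apply, Finset.mul_sum, Finset.sum_mul]
              rw [Finset.sum_comm]
              simp [p, mul_assoc]
          _ = 0 := by simp [hsum]
      have h2 : ∑ i, e i * -(D.b i : ℝ) = 0 := by
        simpa [Prod.snd_sum, p] using congr_arg Prod.snd hsum
      simp only [dF, sub_eq_add_neg, mul_add, Finset.sum_add_distrib, h1, h2, add_zero]
    intro i
    simpa [e] using congr_fun he i
  simpa using hli.fintype_card_le_finrank

end PolyDesc

/-- A surjection `ℤⁿ → ℤᵗ` is, up to an isomorphism, a coordinate projection. -/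
theorem exists_prod_linearEquiv_of_surjective {n t : ℕ} (φ : (Fin n → ℤ) →ₗ[ℤ] (Fin t → ℤ))
    (hφ : Function.Surjective φ) : t ≤ n ∧
    ∃ e : (Fin n → ℤ) ≃ₗ[ℤ] (Fin (n - t) → ℤ) × (Fin t → ℤ), ∀ x, (e x).2 = φ x := by
  obtain ⟨g, hg⟩ := φ.exists_rightInverse_of_surjective (LinearMap.range_eq_top.mpr hφ)
  have hg' : ∀ y, φ (g y) = y := LinearMap.congr_fun hg
  have hrank := Submodule.finrank_quotient_add_finrank (LinearMap.ker φ)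
  rw [(φ.quotKerEquivOfSurjective hφ).finrank_eq, Module.finrank_fin_fun, Module.finrank_fin_fun]
    at hrank
  have hker : Module.finrank ℤ (LinearMap.ker φ) = n - t := by omega
  let κ : LinearMap.ker φ ≃ₗ[ℤ] (Fin (n - t) → ℤ) := (Module.finBasisOfFinrankEq ℤ _ hker).equivFun
  let π : (Fin n → ℤ) →ₗ[ℤ] LinearMap.ker φ :=
    (LinearMap.id - g ∘ₗ φ).codRestrict (LinearMap.ker φ) fun x => by simp [hg']
  have hπ : ∀ x, (π x : Fin n → ℤ) = x - g (φ x) := fun x => rfl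
  refine ⟨by omega, LinearEquiv.ofBijective ((κ.toLinearMap ∘ₗ π).prod φ) ⟨?_, ?_⟩, fun x => rfl⟩
  · rw [← LinearMap.ker_eq_bot, LinearMap.ker_eq_bot']
    intro x hx
    obtain ⟨h1, h2⟩ := Prod.ext_iff.mp hx
    have h2' : φ x = 0 := h2
    have h3 : π x = 0 := κ.map_eq_zero_iff.mp h1
    have h4 := hπ x
    rw [h3, h2', map_zero, sub_zero] at h4
    exact h4.symm
  · rintro ⟨a, y⟩
    refine ⟨(κ.symm a : Fin n → ℤ) + g y, ?_⟩
    have hx : φ ((κ.symm a : Fin n → ℤ) + g y) = y := by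
      rw [map_add, hg', LinearMap.mem_ker.mp (κ.symm a).2, zero_add]
    refine Prod.ext ?_ hx
    have : π ((κ.symm a : Fin n → ℤ) + g y) = κ.symm a := Subtype.ext (by rw [hπ, hx]; simp)
    simp [this]

/-- The real extension of an integral linear map. -/
theorem exists_real_linearMap {a b : ℕ} (L : (Fin a → ℤ) →ₗ[ℤ] (Fin b → ℤ)) :
    ∃ T : (Fin a → ℝ) →ₗ[ℝ] (Fin b → ℝ), ∀ z : Fin a → ℤ,
      T (fun j => (z j : ℝ)) = fun i => (L z i : ℝ) := by
  refine ⟨Fintype.linearCombination ℝ fun j i => (L (Pi.single j 1) i : ℝ), fun z => ?_⟩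
  have hz : L z = ∑ j, z j • L (Pi.single j 1) := by
    conv_lhs => rw [pi_eq_sum_univ' z]
    rw [map_sum]
    simp_rw [map_smul]
  ext i
  simp [Fintype.linearCombination_apply, hz]

/-- Linear maps agreeing on integral vectors are equal. -/
theorem linearMap_ext_intCast {a : ℕ} {M : Type*} [AddCommGroup M] [Module ℝ M]
    {f g : (Fin a → ℝ) →ₗ[ℝ] M} (h : ∀ z : Fin a → ℤ, f (fun j => z j) = g (fun j => z j)) :
    f = g := by
  refine LinearMap.pi_ext' fun j => LinearMap.ext_ring ?_
  have hcast : (Pi.single j 1 : Fin a → ℝ) = fun i => ((Pi.single j 1 : Fin a → ℤ) i : ℝ) := by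
    ext i
    by_cases hij : i = j
    · subst hij; simp
    · simp [hij]
  simpa [hcast] using h (Pi.single j 1)

/-- The real extension of an integral linear isomorphism. -/
theorem exists_real_linearEquiv {n k t : ℕ}
    (e : (Fin n → ℤ) ≃ₗ[ℤ] (Fin k → ℤ) × (Fin t → ℤ)) :
    ∃ E : (Fin n → ℝ) ≃ₗ[ℝ] (Fin k → ℝ) × (Fin t → ℝ), ∀ z : Fin n → ℤ,
      E (fun j => (z j : ℝ)) = (fun j => ((e z).1 j : ℝ), fun j => ((e z).2 j : ℝ)) := by
  obtain ⟨F, hF⟩ := exists_real_linearMap (LinearMap.fst ℤ _ _ ∘ₗ e.toLinearMap)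
  obtain ⟨G, hG⟩ := exists_real_linearMap (LinearMap.snd ℤ _ _ ∘ₗ e.toLinearMap)
  obtain ⟨F', hF'⟩ := exists_real_linearMap (e.symm.toLinearMap ∘ₗ LinearMap.inl ℤ _ _)
  obtain ⟨G', hG'⟩ := exists_real_linearMap (e.symm.toLinearMap ∘ₗ LinearMap.inr ℤ _ _)
  refine ⟨LinearEquiv.ofLinearMap (F.prod G) (F'.coprod G') ?_ ?_, fun z => ?_⟩
  · refine LinearMap.prod_ext (linearMap_ext_intCast fun z => ?_)
      (linearMap_ext_intCast fun z => ?_)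
    · ext i <;> simp [hF', hF, hG]
    · ext i <;> simp [hG', hF, hG]
  · refine linearMap_ext_intCast fun z => ?_
    have h : e.symm ((e z).1, 0) + e.symm (0, (e z).2) = z := by
      rw [← map_add, Prod.mk_add_mk, add_zero, zero_add, Prod.mk.eta, e.symm_apply_apply]
    ext i
    change F' (F fun j => (z j : ℝ)) i + G' (G fun j => (z j : ℝ)) i = (z i : ℝ)
    rw [hF, hG, hF', hG']
    exact (Int.cast_add _ _).symm.trans (congrArg Int.cast (congr_fun h i))
  · ext i <;> simp [hF, hG]

theorem cayleyVec_apply {t : ℕ} (j : Fin (t + 1)) (i : Fin t) :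
    cayleyVec t j i = if i.succ = j then 1 else 0 := by
  induction j using Fin.cases with
  | zero => simp [cayleyVec]
  | succ j => simp [cayleyVec, stdBasisVec]

theorem cayleySum_convexHull {k t : ℕ} (Q : Fin (t + 1) → Set (Fin k → ℝ)) :
    cayleySum (fun j => convexHull ℝ (Q j)) =
      convexHull ℝ (⋃ j, Q j ×ˢ {cayleyVec t j}) := by
  have h : ∀ j, convexHull ℝ (Q j) ×ˢ ({cayleyVec t j} : Set (Fin t → ℝ)) =
      convexHull ℝ (Q j ×ˢ {cayleyVec t j}) := fun j => by
    rw [convexHull_prod, convexHull_singleton]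
  simp only [cayleySum, h]
  exact (convexHull ℝ).closure_iSup_closure _

/-- A lattice polytope is a Cayley polytope of length `t + 1` once the constant function `1` is
a sum of `t + 1` nonzero integral affine functions that are nonnegative on its vertices. -/
theorem isCayley_of_sum_eq_one {n t : ℕ} (V : Finset (Fin n → ℤ)) (A : Fin (t + 1) → Fin n → ℤ)
    (B : Fin (t + 1) → ℤ) (hnonneg : ∀ w ∈ V, ∀ j, 0 ≤ ∑ l, A j l * w l - B j)
    (hsum : ∀ w ∈ V, ∑ j, (∑ l, A j l * w l - B j) = 1)
    (hne : ∀ j, ∃ w ∈ V, ∑ l, A j l * w l - B j ≠ 0) :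
    t ≤ n ∧ IsCayley (convexHull ℝ ((fun z : Fin n → ℤ => fun j => (z j : ℝ)) ''
      (V : Set (Fin n → ℤ)))) (n - t) t := by
  classical
  set d : Fin (t + 1) → (Fin n → ℤ) → ℤ := fun j w => ∑ l, A j l * w l - B j with hd
  have hunique : ∀ w ∈ V, ∀ j, d j w ≠ 0 → ∀ i, d i w = if i = j then 1 else 0 := by
    intro w hw j hj i
    have hsplit : ∑ j, d j w = 1 := hsum w hw
    rw [← Finset.add_sum_erase _ _ (Finset.mem_univ j)] at hsplit
    have hrest : 0 ≤ ∑ i ∈ Finset.univ.erase j, d i w :=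
      Finset.sum_nonneg fun i _ => hnonneg w hw i
    have hjpos : 1 ≤ d j w := by have := hnonneg w hw j; change 0 ≤ d j w at this; omega
    split_ifs with hij
    · subst hij; omega
    · have h0 : ∑ i ∈ Finset.univ.erase j, d i w = 0 := by omega
      exact (Finset.sum_eq_zero_iff_of_nonneg fun i _ => hnonneg w hw i).mp h0 i
        (Finset.mem_erase.mpr ⟨hij, Finset.mem_univ i⟩)
  have hexists : ∀ w ∈ V, ∃ j, d j w ≠ 0 := by
    intro w hw
    by_contra! h
    have := hsum w hw
    change ∑ j, d j w = 1 at this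
    simp [h] at this
  choose p hpV hp using hne
  let φ : (Fin n → ℤ) →ₗ[ℤ] (Fin t → ℤ) := Matrix.mulVecLin (Matrix.of fun i l => A i.succ l)
  have hφ : ∀ w i, φ w i = d i.succ w + B i.succ := fun w i => by
    simp [φ, hd, Matrix.mulVec, dotProduct]
  have hbasis : ∀ j : Fin t, φ (p j.succ - p 0) = Pi.single j 1 := by
    intro j
    ext i
    rw [map_sub, Pi.sub_apply, hφ, hφ, hunique _ (hpV _) _ (hp j.succ),
      hunique _ (hpV _) _ (hp 0)]
    simp [Pi.single_apply]
  have hsurj : Function.Surjective φ := fun y =>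
    ⟨∑ j, y j • (p j.succ - p 0), by
      rw [map_sum]; simp_rw [map_smul, hbasis]; exact (pi_eq_sum_univ' y).symm⟩
  obtain ⟨htn, e, he⟩ := exists_prod_linearEquiv_of_surjective φ hsurj
  obtain ⟨E, hE⟩ := exists_real_linearEquiv e
  let c : (Fin (n - t) → ℝ) × (Fin t → ℝ) := (0, fun i => -(B i.succ : ℝ))
  let f : (Fin n → ℝ) ≃ᵃ[ℝ] (Fin (n - t) → ℝ) × (Fin t → ℝ) :=
    E.toAffineEquiv.trans (AffineEquiv.constVAdd ℝ _ c)
  have hf : ∀ w : Fin n → ℤ, f (fun j => (w j : ℝ)) =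
      (fun j => ((e w).1 j : ℝ), fun i => (d i.succ w : ℝ)) := by
    intro w
    have : f (fun j => (w j : ℝ)) = c + E (fun j => (w j : ℝ)) := rfl
    rw [this, hE]
    ext i
    · simp [c]
    · simp [c, he, hφ]
  have hfV : ∀ w ∈ V, ∀ j, d j w ≠ 0 →
      f (fun j => (w j : ℝ)) = (fun j => ((e w).1 j : ℝ), cayleyVec t j) := by
    intro w hw j hj
    rw [hf]
    refine Prod.ext rfl (funext fun i => ?_)
    change (d i.succ w : ℝ) = cayleyVec t j i
    rw [cayleyVec_apply, hunique w hw j hj]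
    push_cast
    rfl
  refine ⟨htn, Nat.sub_add_cancel htn, fun j => (V.filter fun w => d j w ≠ 0).image fun w => (e w).1,
    fun j => ⟨_, Finset.mem_image_of_mem _ (Finset.mem_filter.mpr ⟨hpV j, hp j⟩)⟩, f, ?_, ?_⟩
  · ext ⟨a, b⟩
    constructor
    · rintro ⟨_, ⟨w, rfl⟩, h⟩
      rw [hf] at h
      obtain ⟨rfl, rfl⟩ := Prod.ext_iff.mp h
      exact ⟨⟨_, rfl⟩, ⟨fun i => d i.succ w, rfl⟩⟩
    · rintro ⟨⟨a, rfl⟩, ⟨b, rfl⟩⟩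
      refine ⟨_, ⟨e.symm (a, fun i => b i + B i.succ), rfl⟩, ?_⟩
      dsimp only
      rw [hf]
      refine Prod.ext (by simp) (funext fun i => ?_)
      have h := hφ (e.symm (a, fun i => b i + B i.succ)) i
      rw [← he, e.apply_symm_apply] at h
      have h' : d i.succ (e.symm (a, fun i => b i + B i.succ)) = b i := by
        dsimp only at h
        omega
      change ((d i.succ _ : ℤ) : ℝ) = (b i : ℝ)
      exact_mod_cast h'
  · rw [cayleySum_convexHull, ← AffineEquiv.coe_toAffineMap, AffineMap.image_convexHull]
    congr 1
    ext q
    simp only [Set.mem_iUnion, Set.mem_image, SetLike.mem_coe, AffineEquiv.coe_toAffineMap]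
    constructor
    · rintro ⟨_, ⟨w, hw, rfl⟩, rfl⟩
      obtain ⟨j, hj⟩ := hexists w hw
      refine ⟨j, ?_⟩
      rw [hfV w hw j hj]
      exact ⟨⟨_, Finset.mem_image_of_mem _ (Finset.mem_filter.mpr ⟨hw, hj⟩), rfl⟩, rfl⟩
    · rintro ⟨j, ⟨_, hx, hx'⟩, hq⟩
      obtain ⟨w, hw, rfl⟩ := Finset.mem_image.mp hx
      obtain ⟨hw, hj⟩ := Finset.mem_filter.mp hw
      exact ⟨_, ⟨w, hw, rfl⟩, (hfV w hw j hj).trans (Prod.ext hx' hq.symm)⟩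

theorem ipair_le_of_mem_convexHull {n : ℕ} {V : Set (Fin n → ℤ)} {a : Fin n → ℤ} {c : ℝ}
    (h : ∀ w ∈ V, ((∑ j, a j * w j : ℤ) : ℝ) ≤ c) {x : Fin n → ℝ}
    (hx : x ∈ convexHull ℝ ((fun z : Fin n → ℤ => fun j => (z j : ℝ)) '' V)) : ipair a x ≤ c := by
  refine convexHull_min ?_ (convex_halfSpace_le (f := ipair a) (ipairLin a).isLinear c) hx
  rintro _ ⟨w, hw, rfl⟩
  simpa only [Set.mem_ofPred_eq, ipair_intCast] using h w hw

theorem lt_ipair_of_mem_convexHull {n : ℕ} {V : Set (Fin n → ℤ)} {a : Fin n → ℤ} {c : ℝ}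
    (h : ∀ w ∈ V, c < ((∑ j, a j * w j : ℤ) : ℝ)) {x : Fin n → ℝ}
    (hx : x ∈ convexHull ℝ ((fun z : Fin n → ℤ => fun j => (z j : ℝ)) '' V)) : c < ipair a x := by
  refine convexHull_min ?_ (convex_halfSpace_gt (f := ipair a) (ipairLin a).isLinear c) hx
  rintro _ ⟨w, hw, rfl⟩
  simpa only [Set.mem_ofPred_eq, ipair_intCast] using h w hw

/-- A finite set contains many indices at which weights bounded by `1` exceed `1 / 2`. -/
theorem Finset.sum_le_card_filter_half_lt {ι : Type*} (s : Finset ι) (c : ι → ℝ)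
    (h1 : ∀ i ∈ s, c i ≤ 1) :
    2 * ∑ i ∈ s, c i ≤ (s.filter fun i => 1 / 2 < c i).card + s.card := by
  classical
  rw [Finset.card_filter, Finset.card_eq_sum_ones]
  push_cast
  rw [Finset.mul_sum, ← Finset.sum_add_distrib]
  refine Finset.sum_le_sum fun i hi => ?_
  have := h1 i hi
  split_ifs with h <;> linarith

namespace PolyDesc
variable {n m : ℕ} {D : PolyDesc n m} {V : Finset (Fin n → ℤ)}

theorem intCast_mem_pts (hV : D.pts = convexHull ℝ
    ((fun z : Fin n → ℤ => fun j => (z j : ℝ)) '' (V : Set (Fin n → ℤ)))) {w : Fin n → ℤ}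
    (hw : w ∈ V) : (fun j => (w j : ℝ)) ∈ D.pts :=
  hV ▸ subset_convexHull ℝ _ ⟨w, hw, rfl⟩

/-- The facet hyperplanes of a lattice polytope are integral. -/
theorem exists_intCast_eq_b (hn : 2 ≤ n) (hV : D.pts = convexHull ℝ
    ((fun z : Fin n → ℤ => fun j => (z j : ℝ)) '' (V : Set (Fin n → ℤ)))) (i : Fin m) :
    ∃ z : ℤ, (D.b i : ℝ) = z := by
  by_contra! h
  obtain ⟨x, hx, hxi⟩ := D.facet_nonempty hn i
  refine (lt_ipair_of_mem_convexHull (fun w hw => ?_) (hV ▸ hx)).ne' hxi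
  refine lt_of_le_of_ne ?_ (h _)
  rw [← ipair_intCast]
  exact intCast_mem_pts hV hw i

theorem IsWeight.le_one (hV : D.pts = convexHull ℝ
    ((fun z : Fin n → ℤ => fun j => (z j : ℝ)) '' (V : Set (Fin n → ℤ)))) {β : Fin m → ℤ}
    (hβ : ∀ i, (D.b i : ℝ) = β i) {q : ℝ} {c : Fin m → ℝ} (hc : D.IsWeight q c) (i : Fin m) :
    c i ≤ 1 := by
  obtain ⟨x, hx, hlt⟩ := D.exists_forall_lt
  have hex : ∃ w ∈ V, (D.b i : ℝ) < ((∑ j, D.A i j * w j : ℤ) : ℝ) := by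
    by_contra! h
    exact (hlt i).not_ge (ipair_le_of_mem_convexHull h (hV ▸ hx))
  obtain ⟨w, hw, hwi⟩ := hex
  have hmem := intCast_mem_pts hV hw
  have h1 : 1 ≤ D.dF i fun j => (w j : ℝ) := by
    rw [dF, ipair_intCast, hβ]
    rw [hβ] at hwi
    have : β i + 1 ≤ ∑ j, D.A i j * w j := by exact_mod_cast hwi
    have : (β i : ℝ) + 1 ≤ ((∑ j, D.A i j * w j : ℤ) : ℝ) := by exact_mod_cast this
    linarith
  have h2 := Finset.single_le_sum (f := fun i => c i * D.dF i fun j => (w j : ℝ))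
    (fun j _ => mul_nonneg (hc.nonneg j) (sub_nonneg.mpr (hmem j))) (Finset.mem_univ i)
  rw [hc.sum_mul _ hmem] at h2
  nlinarith [hc.nonneg i]

/-- A linearly independent weight of total size more than `c > n / 2` exhibits a lattice polytope
as a Cayley polytope. -/
theorem IsWeight.isCayley (hn : 2 ≤ n) (hV : D.pts = convexHull ℝ
    ((fun z : Fin n → ℤ => fun j => (z j : ℝ)) '' (V : Set (Fin n → ℤ)))) {c : ℕ}
    {l : Fin m → ℝ} (hl : D.IsWeight c l)
    (hind : ∀ e : Fin m → ℝ, (∀ i, l i = 0 → e i = 0) →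
      (∀ x ∈ D.pts, ∑ i, e i * D.dF i x = 0) → e = 0) (hc : n < 2 * c) :
    c ≤ n ∧ IsCayley D.pts (n - (2 * c - n)) (2 * c - n) := by
  classical
  choose β hβ using exists_intCast_eq_b hn hV
  have hle := hl.le_one hV hβ
  set T := Finset.univ.filter fun i => l i ≠ 0 with hT
  have hTcard : T.card ≤ n + 1 := card_le_of_independent fun e he =>
    hind e fun i hi => he i (by simp [hT, hi])
  have hsumT : ∑ i ∈ T, l i = ∑ i, l i := by rw [hT, Finset.sum_filter_ne_zero]
  have hlt : (c : ℝ) < ∑ i ∈ T, l i := hsumT ▸ hl.lt_sum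
  have hcn : c ≤ n := by
    have h := Finset.sum_le_card_nsmul T l 1 fun i _ => hle i
    rw [nsmul_one] at h
    have : c < T.card := by exact_mod_cast hlt.trans_le h
    omega
  have hhalf := Finset.sum_le_card_filter_half_lt T l fun i _ => hle i
  have hI : 2 * c - n ≤ (T.filter fun i => 1 / 2 < l i).card := by
    have : 2 * c < (T.filter fun i => 1 / 2 < l i).card + T.card := by
      have : 2 * (c : ℝ) < (T.filter fun i => 1 / 2 < l i).card + T.card := by linarith
      exact_mod_cast this
    omega
  obtain ⟨J, hJ, hJcard⟩ := Finset.exists_subset_card_eq hI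
  have hJhalf : ∀ i ∈ J, 1 / 2 < l i := fun i hi => (Finset.mem_filter.mp (hJ hi)).2
  set t := 2 * c - n with ht
  let σ : Fin t ≃ J := (J.equivFinOfCardEq hJcard).symm
  let d : Fin m → (Fin n → ℤ) → ℤ := fun i w => ∑ j, D.A i j * w j - β i
  have hd : ∀ i w, D.dF i (fun j => (w j : ℝ)) = d i w := fun i w => by
    rw [dF, ipair_intCast, hβ, ← Int.cast_sub]
  have hd0 : ∀ w ∈ V, ∀ i, 0 ≤ d i w := fun w hw i => by
    have : (0 : ℝ) ≤ d i w := by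
      rw [← hd]
      exact sub_nonneg.mpr (intCast_mem_pts hV hw i)
    exact_mod_cast this
  have hσ : ∀ w, ∑ j : Fin t, d (σ j) w = ∑ i ∈ J, d i w := fun w => by
    rw [← Finset.sum_coe_sort J]
    exact σ.sum_comp fun i : J => d i w
  have hsumJ : ∀ w ∈ V, ∑ i ∈ J, d i w ≤ 1 := by
    intro w hw
    by_contra! h
    have hone := hl.sum_mul _ (intCast_mem_pts hV hw)
    simp_rw [hd] at hone
    have hsub : ∑ i ∈ J, l i * d i w ≤ 1 := hone ▸
      Finset.sum_le_sum_of_subset_of_nonneg (Finset.subset_univ J) fun i _ _ =>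
        mul_nonneg (hl.nonneg i) (by exact_mod_cast hd0 w hw i)
    obtain ⟨i, hi, hdi⟩ : ∃ i ∈ J, 0 < d i w := by
      by_contra! hall
      linarith [Finset.sum_nonpos hall]
    have hlow : ∑ i ∈ J, 1 / 2 * (d i w : ℝ) < ∑ i ∈ J, l i * d i w :=
      Finset.sum_lt_sum (fun i hi => mul_le_mul_of_nonneg_right (hJhalf i hi).le
        (by exact_mod_cast hd0 w hw i))
        ⟨i, hi, mul_lt_mul_of_pos_right (hJhalf i hi) (by exact_mod_cast hdi)⟩
    rw [← Finset.mul_sum] at hlow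
    have : (2 : ℝ) ≤ ∑ i ∈ J, (d i w : ℝ) := by exact_mod_cast h
    linarith
  have hne0 : ∃ w ∈ V, ∑ i ∈ J, d i w ≠ 1 := by
    by_contra! hall
    have hP : ∀ x ∈ D.pts, ∑ i ∈ J, D.dF i x = 1 := by
      have hsub : D.pts ⊆ {x | (∑ i ∈ J, ipairLin (D.A i)) x = 1 + ∑ i ∈ J, (D.b i : ℝ)} := by
        rw [hV]
        refine convexHull_min ?_ (convex_hyperplane (LinearMap.isLinear _) _)
        rintro _ ⟨w, hw, rfl⟩
        have h1 : ∑ i ∈ J, D.dF i (fun j => (w j : ℝ)) = 1 := by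
          simp_rw [hd]
          exact_mod_cast hall w hw
        simp only [dF, Finset.sum_sub_distrib] at h1
        simpa [LinearMap.sum_apply, ipairLin_apply] using eq_add_of_sub_eq h1
      intro x hx
      have h1 := hsub hx
      simp only [Set.mem_ofPred_eq, LinearMap.sum_apply, ipairLin_apply] at h1
      simp only [dF, Finset.sum_sub_distrib]
      linarith
    have he := hind (fun i => l i - if i ∈ J then 1 else 0) (fun i hi => by
      have : i ∉ J := fun h => by have := hJhalf i h; rw [hi] at this; norm_num at this
      simp [hi, this]) fun x hx => by
        simp [sub_mul, Finset.sum_sub_distrib, hl.sum_mul x hx, hP x hx]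
    have hlJ : ∑ i, l i = J.card := by
      have : ∑ i, (l i - if i ∈ J then 1 else 0) = 0 :=
        Finset.sum_eq_zero fun i _ => congr_fun he i
      simpa [Finset.sum_sub_distrib, sub_eq_zero] using this
    have := hl.lt_sum
    rw [hlJ, hJcard] at this
    have : c < t := by exact_mod_cast this
    omega
  have hkey := isCayley_of_sum_eq_one V
    (Fin.cons (-∑ i ∈ J, D.A i) fun j : Fin t => D.A (σ j))
    (Fin.cons (-1 - ∑ i ∈ J, β i) fun j : Fin t => β (σ j))
  have h0 : ∀ w : Fin n → ℤ, ∑ k, (-∑ i ∈ J, D.A i) k * w k - (-1 - ∑ i ∈ J, β i) =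
      1 - ∑ i ∈ J, d i w := fun w => by
    simp only [d, Finset.sum_sub_distrib, Pi.neg_apply, Finset.sum_apply, neg_mul, Finset.sum_mul,
      Finset.sum_neg_distrib]
    rw [Finset.sum_comm]
    ring
  refine ⟨hcn, hV ▸ (hkey (fun w hw j => ?_) (fun w hw => ?_) fun j => ?_).2⟩
  · induction j using Fin.cases with
    | zero =>
      simp only [Fin.cons_zero, h0]
      linarith [hsumJ w hw]
    | succ j => simpa only [Fin.cons_succ] using hd0 w hw (σ j)
  · rw [Fin.sum_univ_succ]
    simp only [Fin.cons_zero, Fin.cons_succ, h0]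
    have : ∑ j : Fin t, (∑ k, D.A (σ j) k * w k - β (σ j)) = ∑ i ∈ J, d i w := hσ w
    rw [this]
    ring
  · induction j using Fin.cases with
    | zero =>
      obtain ⟨w, hw, h⟩ := hne0
      refine ⟨w, hw, ?_⟩
      simp only [Fin.cons_zero, h0]
      omega
    | succ j =>
      simp only [Fin.cons_succ]
      by_contra! h
      obtain ⟨x, hx, hlt⟩ := D.exists_forall_lt
      refine (hlt (σ j)).not_ge (ipair_le_of_mem_convexHull (fun w hw => ?_) (hV ▸ hx))
      rw [hβ, sub_eq_zero.mp (h w hw)]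

/-- The Cayley decomposition in dimension at least `2`. -/
theorem exists_isCayley_of_two_le (hn : 2 ≤ n) (hlat : IsLatticePoly D.pts)
    (hGor : ∀ v ∈ Set.extremePoints ℝ D.pts, ∃ u : Fin n → ℤ, D.VertexQG v u 1)
    (hQN : D.qcd = D.nefVal) (hcd : n + 2 < 2 * D.codeg) :
    ∃ k t : ℕ, k + 2 * D.codeg = 2 * (n + 1) ∧ IsCayley D.pts k t := by
  obtain ⟨c, hc⟩ : ∃ c, D.codeg = c + 1 := ⟨D.codeg - 1, by omega⟩
  have hlt := D.qcdInv_lt_inv_of_lt_codeg hn hlat hGor hQN (c := c) (by omega) (by omega)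
  obtain ⟨s, hs1, hs2⟩ := exists_between hlt
  have hs : 0 < s := D.qcdInv_pos.trans hs1
  have hempty : D.adj s = ∅ := by
    by_contra h
    exact hs1.not_ge (le_csSup D.bddAbove_qcdInvSet ⟨hs, Set.nonempty_iff_ne_empty.mpr h⟩)
  obtain ⟨l, hl0, hl1, hl2⟩ := D.exists_weights_of_adj_eq_empty hs hempty
  have hcs : (c : ℝ) < s⁻¹ := by
    rwa [lt_inv_comm₀ (by exact_mod_cast (by omega : 0 < c)) hs]
  obtain ⟨l', hl', hind⟩ :=
    IsWeight.exists_independent ⟨hl0, fun x _ => hl1 x, hcs.trans_le hl2⟩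
  obtain ⟨V, hV⟩ := hlat
  obtain ⟨hcn, hcay⟩ := hl'.isCayley hn hV hind (by omega)
  exact ⟨_, _, by omega, hcay⟩

end PolyDesc

namespace PolyDesc

/-- A lattice segment of codegree at least `2` is unimodular. -/
theorem isCayley_of_dim_one {m : ℕ} (D : PolyDesc 1 m) (hlat : IsLatticePoly D.pts)
    (hcd : 2 ≤ D.codeg) : D.codeg = 2 ∧ IsCayley D.pts 0 1 := by
  classical
  obtain ⟨V, hV⟩ := hlat
  have hVne : V.Nonempty := by
    by_contra h
    have := D.pts_nonempty
    rw [hV, Finset.not_nonempty_iff_eq_empty.mp h] at this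
    simp at this
  obtain ⟨p, hp, hmin⟩ := V.exists_min_image (fun w => w 0) hVne
  obtain ⟨q, hq, hmax⟩ := V.exists_max_image (fun w => w 0) hVne
  have hpq : p 0 < q 0 := by
    by_contra! h
    have hVp : V = {p} := Finset.eq_singleton_iff_unique_mem.mpr ⟨hp, fun w hw => by
      have h1 := hmin w hw
      have h2 := hmax w hw
      ext i
      rw [Subsingleton.elim i 0]
      omega⟩
    refine D.not_forall_ipair_eq (one_ne_zero (α := Fin 1 → ℤ)) (ipair 1 fun j => (p j : ℝ))
      fun x hx => ?_
    rw [hV, hVp] at hx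
    simp only [Finset.coe_singleton, Set.image_singleton, convexHull_singleton,
      Set.mem_singleton_iff] at hx
    rw [hx]
  have hpq' : (p 0 : ℝ) < q 0 := by exact_mod_cast hpq
  have hIoo : ∀ y : Fin 1 → ℝ, (p 0 : ℝ) < y 0 → y 0 < q 0 → y ∈ D.pts := by
    intro y h1 h2
    have hpos : (0 : ℝ) < q 0 - p 0 := sub_pos.mpr hpq'
    have hy : ((q 0 - y 0) / (q 0 - p 0)) • (fun j => (p j : ℝ)) +
        ((y 0 - p 0) / (q 0 - p 0)) • (fun j => (q j : ℝ)) = y := by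
      ext i
      rw [Subsingleton.elim i 0]
      simp only [Pi.add_apply, Pi.smul_apply, smul_eq_mul]
      field_simp
      ring
    rw [← hy]
    exact D.convex_pts (intCast_mem_pts hV hp) (intCast_mem_pts hV hq)
      (div_nonneg (by linarith) hpos.le) (div_nonneg (by linarith) hpos.le)
      (by field_simp; ring)
  have hcodeg : ∀ (k : ℕ) (z : ℤ), 0 < k → k * p 0 < z → z < k * q 0 → D.codeg ≤ k := by
    intro k z hk h1 h2
    have hk' : (0 : ℝ) < k := by exact_mod_cast hk
    refine Nat.sInf_le ⟨hk, fun _ => z, mem_interior.mpr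
      ⟨{x | (k : ℝ) * p 0 < x 0 ∧ x 0 < k * q 0}, fun x hx => ?_, ?_, ?_⟩⟩
    · rw [Set.mem_smul_set_iff_inv_smul_mem₀ hk'.ne']
      refine hIoo _ ?_ ?_
      · rw [Pi.smul_apply, smul_eq_mul, lt_inv_mul_iff₀ hk']
        exact hx.1
      · rw [Pi.smul_apply, smul_eq_mul, inv_mul_lt_iff₀ hk']
        exact hx.2
    · exact (isOpen_lt continuous_const (continuous_apply 0)).inter
        (isOpen_lt (continuous_apply 0) continuous_const)
    · change (k : ℝ) * p 0 < (z : ℝ) ∧ (z : ℝ) < k * q 0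
      exact ⟨by exact_mod_cast h1, by exact_mod_cast h2⟩
  have hq1 : q 0 = p 0 + 1 := by
    by_contra h
    have := hcodeg 1 (p 0 + 1) one_pos (by push_cast; omega) (by push_cast; omega)
    omega
  have h2 := hcodeg 2 (2 * p 0 + 1) two_pos (by push_cast; omega) (by push_cast; omega)
  refine ⟨by omega, hV ▸ (isCayley_of_sum_eq_one (t := 1) V ![fun _ => -1, fun _ => 1]
    ![-(p 0 + 1), p 0] (fun w hw j => ?_) (fun w hw => ?_) fun j => ?_).2⟩
  · have h1 := hmin w hw
    have h2 := hmax w hw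
    fin_cases j <;> simp <;> omega
  · simp
  · fin_cases j
    · exact ⟨p, hp, by simp⟩
    · exact ⟨q, hq, by simp [hq1]⟩

end PolyDesc

/-- Let `P` be an `n`-dimensional lattice polytope whose normal fan
is Gorenstein (ℚ-Gorenstein of index 1) and which is ℚ-normal (`μ(P) = τ(P)`). If
`cd(P) > (n+2)/2`, then `P` is unimodularly equivalent to a Cayley sum of lattice
polytopes of dimension at most `2(n + 1 - cd(P))`. -/
theorem statement17 {n m : ℕ} (D : PolyDesc n m) (hlat : IsLatticePoly D.pts)
    (hGor : ∀ v ∈ Set.extremePoints ℝ D.pts, ∃ u : Fin n → ℤ, D.VertexQG v u 1)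
    (hQN : D.qcd = D.nefVal)
    (hcd : ((n : ℝ) + 2) / 2 < (D.codeg : ℝ)) :
    ∃ k t : ℕ, (k : ℝ) ≤ 2 * ((n : ℝ) + 1 - (D.codeg : ℝ)) ∧ IsCayley D.pts k t := by
  have hcd' : n + 2 < 2 * D.codeg := by
    have : (n : ℝ) + 2 < 2 * D.codeg := by linarith
    exact_mod_cast this
  rcases D.one_le_dim.eq_or_lt' with rfl | hn
  · obtain ⟨h2, h⟩ := D.isCayley_of_dim_one hlat (by omega)
    refine ⟨0, 1, ?_, h⟩
    rw [h2]
    norm_num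
  · obtain ⟨k, t, hk, h⟩ := PolyDesc.exists_isCayley_of_two_le hn hlat hGor hQN hcd'
    refine ⟨k, t, ?_, h⟩
    have : (k : ℝ) + 2 * D.codeg = 2 * (n + 1) := by exact_mod_cast hk
    linarith

end
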